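/- Assume C∖H ≠ ∅. Then Γ is a class one graph: its edges admit a proper edge coloring with Δ(Γ) colors, where Δ(Γ) = |C| is the maximum degree of Γ; equivalently, the chromatic index χ'(Γ) (the chromatic number of the line graph of Γ) equals |C|. -/

import Mathlib

open scoped Pointwise

/-- The relative Cayley graph `Cay(G, H, C)`: vertices are the elements of `G`, and distinct
vertices `x`, `y` are adjacent iff (`x ∈ H` or `y ∈ H`) and `x⁻¹ * y ∈ C`, where `C` is an
inverse-closed subset of `G \ {1}`. -/
def relCayley {G : Type*} [Group G] (H : Subgroup G) (C : Set G)
    (hC : ∀ c ∈ C, c⁻¹ ∈ C) : SimpleGraph G where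
  Adj x y := x ≠ y ∧ (x ∈ H ∨ y ∈ H) ∧ x⁻¹ * y ∈ C
  symm := by
    constructor
    rintro x y ⟨h1, h2, h3⟩
    exact ⟨h1.symm, h2.symm, by simpa using hC _ h3⟩
  loopless := ⟨fun x h => h.1 rfl⟩

open scoped Classical in
theorem SimpleGraph.ConnectedComponent.card_filter_le_two {V : Type*} [Fintype V]
    {L : SimpleGraph V} (S : L.ConnectedComponent) (X : Finset V)
    (h2 : ∀ x, L.degree x ≤ 2) (hX : ∀ x ∈ X, L.degree x ≤ 1) :
    (X.filter fun x => L.connectedComponentMk x = S).card ≤ 2 := by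
  have hconn := S.connected_toSimpleGraph.card_vert_le_card_edgeSet_add_one
  have hsum := S.toSimpleGraph.sum_degrees_eq_twice_card_edges
  rw [Nat.card_eq_fintype_card, Nat.card_eq_fintype_card, ← SimpleGraph.edgeFinset_card] at hconn
  have hdeg (x : S) : S.toSimpleGraph.degree x ≤ L.degree x := by
    rw [← SimpleGraph.card_neighborFinset_eq_degree, ← SimpleGraph.card_neighborFinset_eq_degree]
    refine Finset.card_le_card_of_injOn Subtype.val (fun y hy => ?_) Subtype.val_injective.injOn
    rw [SimpleGraph.coe_neighborFinset] at hy ⊢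
    exact hy
  have hle (x : S) : S.toSimpleGraph.degree x + (if (x : V) ∈ X then 1 else 0) ≤ 2 := by
    have := hdeg x
    have := h2 x
    split_ifs with hx
    · have := hX x hx
      omega
    · omega
  have hcard : (X.filter fun x => L.connectedComponentMk x = S).card
      ≤ ∑ x : S, if (x : V) ∈ X then 1 else 0 := by
    rw [← Finset.card_filter]
    refine Finset.card_le_card_of_surjOn Subtype.val fun x hx => ?_
    simp only [Finset.coe_filter, Set.mem_ofPred_eq] at hx
    exact ⟨⟨x, hx.2⟩, by simpa using hx.1, rfl⟩
  have htot := Finset.sum_le_sum fun (x : S) (_ : x ∈ Finset.univ) => hle x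
  rw [Finset.sum_add_distrib, Finset.sum_const, Finset.card_univ, smul_eq_mul] at htot
  omega

open scoped Classical in
theorem SimpleGraph.exists_closed_set_card_lt {V : Type*} [Fintype V] {L : SimpleGraph V}
    (X Y : Finset V) (h2 : ∀ x, L.degree x ≤ 2) (hX : ∀ x ∈ X, L.degree x ≤ 1)
    (hYX : Y.card < X.card) :
    ∃ S : Set V, (∀ x y, L.Adj x y → (x ∈ S ↔ y ∈ S)) ∧
      (Y.filter (· ∈ S)).card < (X.filter (· ∈ S)).card ∧ (X.filter (· ∈ S)).card ≤ 2 := by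
  rw [Finset.card_eq_sum_card_fiberwise (f := L.connectedComponentMk) (t := Finset.univ)
      (fun _ _ => by simp),
    Finset.card_eq_sum_card_fiberwise (s := X) (f := L.connectedComponentMk) (t := Finset.univ)
      (fun _ _ => by simp)] at hYX
  obtain ⟨S, -, hS⟩ := Finset.exists_lt_of_sum_lt hYX
  refine ⟨{x | L.connectedComponentMk x = S}, fun x y hxy => ?_, hS,
    S.card_filter_le_two X h2 hX⟩
  simp [ConnectedComponent.connectedComponentMk_eq_of_adj hxy]

/-- `c` restricts to a proper edge coloring of `F`. -/
def SimpleGraph.IsProperEdgeColoring {V κ : Type*} (F : SimpleGraph V) (c : Sym2 V → κ) : Prop :=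
  ∀ ⦃x y z⦄, F.Adj x y → F.Adj x z → c s(x, y) = c s(x, z) → y = z

/-- The color `i` does not occur on the edges of `F` at `x`. -/
def SimpleGraph.IsMissing {V κ : Type*} (F : SimpleGraph V) (c : Sym2 V → κ) (x : V) (i : κ) :
    Prop :=
  ∀ ⦃y⦄, F.Adj x y → c s(x, y) ≠ i

/-- The subgraph of `F` formed by the edges of color `i` or `j`. -/
def SimpleGraph.kempe {V κ : Type*} (F : SimpleGraph V) (c : Sym2 V → κ) (i j : κ) :
    SimpleGraph V where
  Adj x y := F.Adj x y ∧ (c s(x, y) = i ∨ c s(x, y) = j)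
  symm := ⟨fun x y h => ⟨h.1.symm, by rw [Sym2.eq_swap]; exact h.2⟩⟩
  loopless := ⟨fun _ h => F.irrefl h.1⟩

open scoped Classical in
theorem SimpleGraph.IsProperEdgeColoring.kempe_degree_le {V κ : Type*} [Fintype V]
    {F : SimpleGraph V} {c : Sym2 V → κ} (hc : F.IsProperEdgeColoring c) (i j : κ) (x : V) :
    (F.kempe c i j).degree x ≤ 2 ∧ (F.IsMissing c x i → (F.kempe c i j).degree x ≤ 1) := by
  have hinj : Set.InjOn (fun y => c s(x, y)) ((F.kempe c i j).neighborFinset x) := by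
    intro y hy z hz h
    rw [SimpleGraph.coe_neighborFinset] at hy hz
    exact hc hy.1 hz.1 h
  rw [← SimpleGraph.card_neighborFinset_eq_degree]
  refine ⟨(Finset.card_le_card_of_injOn (t := {i, j}) _ (fun y hy => ?_) hinj).trans
    Finset.card_le_two, fun hi =>
    (Finset.card_le_card_of_injOn (t := {j}) _ (fun y hy => ?_) hinj).trans (by simp)⟩
  · rw [SimpleGraph.coe_neighborFinset] at hy
    simpa using hy.2
  · rw [SimpleGraph.coe_neighborFinset] at hy
    simpa using hy.2.resolve_left (hi hy.1)

open scoped Classical in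
/-- Swapping two colors on a set closed under the edges of these colors. -/
theorem SimpleGraph.exists_recoloring {V κ : Type*} (F : SimpleGraph V) (c : Sym2 V → κ)
    (i j : κ) (S : Set V) (hS : ∀ x y, (F.kempe c i j).Adj x y → (x ∈ S ↔ y ∈ S)) :
    ∃ c' : Sym2 V → κ, (∀ e, c' e = c e ∨ c' e = Equiv.swap i j (c e)) ∧
      ∀ x y, F.Adj x y →
        c' s(x, y) = (if x ∈ S then Equiv.swap i j else 1 : Equiv.Perm κ) (c s(x, y)) := by
  refine ⟨fun e => if ∃ x ∈ e, x ∈ S then Equiv.swap i j (c e) else c e, fun e => ?_,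
    fun x y hxy => ?_⟩
  · dsimp only
    split_ifs <;> simp
  · by_cases hx : x ∈ S
    · simp [hx]
    by_cases hy : y ∈ S
    · have hij : ¬ (c s(x, y) = i ∨ c s(x, y) = j) := fun h => hx ((hS x y ⟨hxy, h⟩).2 hy)
      push Not at hij
      simp [hx, hy, Equiv.swap_apply_of_ne_of_ne hij.1 hij.2]
    · simp [hx, hy]

/-- `M` assigns to the vertices of `N` sets of missing colors from `K`, of size two except for
one vertex, where the size is one. -/
structure SimpleGraph.IsFan {V κ : Type*} (F : SimpleGraph V) (c : Sym2 V → κ) (N : Finset V)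
    (K : Finset κ) (u₀ : V) (M : V → Finset κ) : Prop where
  proper : F.IsProperEdgeColoring c
  subset : ∀ u ∈ N, M u ⊆ K
  isMissing : ∀ u ∈ N, ∀ i ∈ M u, F.IsMissing c u i
  mem : u₀ ∈ N
  card_one : (M u₀).card = 1
  card_two : ∀ u ∈ N, u ≠ u₀ → (M u).card = 2

/-- `c'` differs from `c` only on elements with colors in `K`, which keep colors in `K`. -/
def AgreeOutside {E κ : Type*} (K : Finset κ) (c c' : E → κ) : Prop :=
  ∀ e, (c e ∈ K → c' e ∈ K) ∧ (c e ∉ K → c' e = c e)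

theorem AgreeOutside.trans {E κ : Type*} {K : Finset κ} {c c' c'' : E → κ}
    (h : AgreeOutside K c c') (h' : AgreeOutside K c' c'') : AgreeOutside K c c'' := fun e =>
  ⟨fun he => (h' e).1 ((h e).1 he), fun he => by
    have := (h e).2 he
    rw [← this, (h' e).2 (this ▸ he)]⟩

theorem AgreeOutside.mono {E κ : Type*} {K K' : Finset κ} {c c' : E → κ}
    (h : AgreeOutside K c c') (hK : K ⊆ K') : AgreeOutside K' c c' := fun e => by
  have := h e
  by_cases he : c e ∈ K
  · exact ⟨fun _ => hK (this.1 he), fun h' => absurd (hK he) h'⟩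
  · have heq := this.2 he
    exact ⟨fun h' => heq ▸ h', fun _ => heq⟩

open scoped Classical in
theorem SimpleGraph.IsFan.sum_card {V κ : Type*} {F : SimpleGraph V} {c : Sym2 V → κ}
    {N : Finset V} {K : Finset κ} {u₀ : V} {M : V → Finset κ} (h : F.IsFan c N K u₀ M) :
    ∑ i ∈ K, (N.filter (i ∈ M ·)).card + 1 = 2 * N.card := by
  have hcount := Finset.sum_card_bipartiteAbove_eq_sum_card_bipartiteBelow
    (fun u i => i ∈ M u) (s := N) (t := K)
  have hM : ∀ u ∈ N, (Finset.bipartiteAbove (fun u i => i ∈ M u) K u).card = (M u).card := by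
    intro u hu
    congr 1
    ext i
    simpa [Finset.bipartiteAbove] using fun hi => h.subset u hu hi
  rw [Finset.sum_congr rfl hM, ← Finset.sum_erase_add _ _ h.mem, h.card_one,
    Finset.sum_congr rfl fun u hu => h.card_two u (Finset.mem_of_mem_erase hu)
      (Finset.ne_of_mem_erase hu), Finset.sum_const, Finset.card_erase_of_mem h.mem] at hcount
  have := Finset.card_pos.2 ⟨_, h.mem⟩
  simp only [Finset.bipartiteBelow, smul_eq_mul] at hcount
  omega

open scoped Classical in
theorem SimpleGraph.IsFan.exists_sum_sq_lt {V κ : Type*} [Finite V] {F : SimpleGraph V}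
    {c : Sym2 V → κ} {N : Finset V} {K : Finset κ} {u₀ : V} {M : V → Finset κ}
    (h : F.IsFan c N K u₀ M) {i j : κ} (hi : i ∈ K) (hj : j ∈ K)
    (hij : (N.filter (j ∈ M ·)).card + 3 ≤ (N.filter (i ∈ M ·)).card) :
    ∃ c' M', F.IsFan c' N K u₀ M' ∧ AgreeOutside K c c' ∧
      ∑ k ∈ K, (N.filter (k ∈ M' ·)).card ^ 2 < ∑ k ∈ K, (N.filter (k ∈ M ·)).card ^ 2 := by
  have := Fintype.ofFinite V
  have hne : i ≠ j := by
    rintro rfl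
    omega
  obtain ⟨S, hS, hlt, hle⟩ := SimpleGraph.exists_closed_set_card_lt (L := F.kempe c i j)
    (N.filter (i ∈ M ·)) (N.filter (j ∈ M ·)) (fun x => (h.proper.kempe_degree_le i j x).1)
    (fun x hx => (h.proper.kempe_degree_le i j x).2 <| by
      rw [Finset.mem_filter] at hx
      exact h.isMissing x hx.1 i hx.2) (by omega)
  obtain ⟨c', hcc', hc'⟩ := F.exists_recoloring c i j S hS
  set π : V → Equiv.Perm κ := fun x => if x ∈ S then Equiv.swap i j else 1 with hπ
  have hswap {k : κ} : Equiv.swap i j k ∈ K ↔ k ∈ K := by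
    rw [Equiv.swap_apply_def]
    split_ifs <;> simp_all
  have hmem (k : κ) (x : V) : k ∈ (M x).map (π x).toEmbedding ↔
      (if x ∈ S then Equiv.swap i j k else k) ∈ M x := by
    simp only [Finset.mem_map_equiv, hπ]
    split_ifs
    · rw [Equiv.symm_swap]
    · rfl
  refine ⟨c', fun x => (M x).map (π x).toEmbedding, ⟨?_, ?_, ?_, h.mem, ?_, ?_⟩, ?_, ?_⟩
  · intro x y z hy hz hyz
    rw [hc' x y hy, hc' x z hz] at hyz
    exact h.proper hy hz ((π x).injective hyz)
  · intro u hu k hk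
    rw [hmem] at hk
    have := h.subset u hu hk
    split_ifs at this
    · exact hswap.1 this
    · exact this
  · intro u hu k hk y hy hk'
    obtain ⟨l, hl, rfl⟩ := Finset.mem_map.1 hk
    rw [hc' u y hy] at hk'
    exact h.isMissing u hu l hl hy ((π u).injective hk')
  · simpa using h.card_one
  · intro u hu hu'
    simpa using h.card_two u hu hu'
  · intro e
    rcases hcc' e with he | he
    · rw [he]
      exact ⟨id, fun _ => rfl⟩
    · rw [he]
      refine ⟨hswap.2, fun hk => Equiv.swap_apply_of_ne_of_ne ?_ ?_⟩ <;> rintro rfl <;>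
        contradiction
  · simp only [hmem]
    have hji : j ∈ K.erase i := Finset.mem_erase.2 ⟨hne.symm, hj⟩
    rw [← Finset.add_sum_erase K _ hi, ← Finset.add_sum_erase K _ hi,
      ← Finset.add_sum_erase _ _ hji, ← Finset.add_sum_erase _ _ hji, ← add_assoc, ← add_assoc]
    refine add_lt_add_of_lt_of_le ?_ (Finset.sum_le_sum fun k hk => ?_)
    · have split (p : V → Prop) [DecidablePred p] : (N.filter p).card =
          ((N.filter p).filter (· ∈ S)).card + ((N.filter p).filter (· ∉ S)).card :=
        (Finset.card_filter_add_card_filter_not _).symm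
      have e1 : (N.filter fun x => (if x ∈ S then Equiv.swap i j i else i) ∈ M x).card =
          ((N.filter (j ∈ M ·)).filter (· ∈ S)).card +
          ((N.filter (i ∈ M ·)).filter (· ∉ S)).card := by
        rw [split]
        congr 2 <;> ext x <;> simp +contextual [Finset.mem_filter]
      have e2 : (N.filter fun x => (if x ∈ S then Equiv.swap i j j else j) ∈ M x).card =
          ((N.filter (i ∈ M ·)).filter (· ∈ S)).card +
          ((N.filter (j ∈ M ·)).filter (· ∉ S)).card := by
        rw [split]
        congr 2 <;> ext x <;> simp +contextual [Finset.mem_filter]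
      have e3 := split (i ∈ M ·)
      have e4 := split (j ∈ M ·)
      rw [e1, e2]
      rw [e3, e4] at hij ⊢
      nlinarith
    · have hk1 := Finset.ne_of_mem_erase hk
      have hk2 := Finset.ne_of_mem_erase (Finset.mem_of_mem_erase hk)
      simp [Equiv.swap_apply_of_ne_of_ne hk2 hk1]

open scoped Classical in
theorem SimpleGraph.IsFan.exists_card_eq_one {V κ : Type*} [Finite V] {F : SimpleGraph V}
    {c : Sym2 V → κ} {N : Finset V} {K : Finset κ} {u₀ : V} {M : V → Finset κ}
    (h : F.IsFan c N K u₀ M) (hNK : N.card ≤ K.card) :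
    ∃ c' M', F.IsFan c' N K u₀ M' ∧ AgreeOutside K c c' ∧
      ∃ i ∈ K, (N.filter (i ∈ M' ·)).card = 1 := by
  induction hn : ∑ k ∈ K, (N.filter (k ∈ M ·)).card ^ 2 using Nat.strong_induction_on
    generalizing c M with
  | _ n ih =>
    by_cases hone : ∃ i ∈ K, (N.filter (i ∈ M ·)).card = 1
    · exact ⟨c, M, h, fun e => ⟨id, fun _ => rfl⟩, hone⟩
    push Not at hone
    have hsum := h.sum_card
    obtain ⟨j, hj, hj2⟩ : ∃ j ∈ K, (N.filter (j ∈ M ·)).card < 2 := by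
      by_contra! hcon
      have := Finset.card_nsmul_le_sum K _ 2 hcon
      rw [smul_eq_mul] at this
      omega
    obtain ⟨i, hi, hi3⟩ : ∃ i ∈ K, 3 ≤ (N.filter (i ∈ M ·)).card := by
      by_contra! hcon
      have : 2 ∣ ∑ i ∈ K, (N.filter (i ∈ M ·)).card := Finset.dvd_sum fun i hi => by
        have := hcon i hi
        have := hone i hi
        omega
      omega
    have := hone j hj
    obtain ⟨c', M', h', hcc', hlt⟩ := h.exists_sum_sq_lt hi hj (by omega)
    obtain ⟨c'', M'', h'', hcc'', hex⟩ := ih _ (hn ▸ hlt) h' rfl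
    exact ⟨c'', M'', h'', hcc'.trans hcc'', hex⟩

open scoped Classical in
theorem SimpleGraph.IsFan.exists_injOn {V κ : Type*} [Finite V] {F : SimpleGraph V}
    {c : Sym2 V → κ} {N : Finset V} {K : Finset κ} {u₀ : V} {M : V → Finset κ}
    (h : F.IsFan c N K u₀ M) (hNK : N.card ≤ K.card) :
    ∃ c' : Sym2 V → κ, F.IsProperEdgeColoring c' ∧ AgreeOutside K c c' ∧
      ∃ f : V → κ, Set.InjOn f N ∧ ∀ u ∈ N, f u ∈ K ∧ F.IsMissing c' u (f u) := by
  induction hn : N.card generalizing c N K u₀ M with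
  | zero =>
    have := Finset.card_pos.2 ⟨_, h.mem⟩
    omega
  | succ n ih =>
    obtain ⟨c₁, M₁, h₁, hcc₁, i, hi, hcard⟩ := h.exists_card_eq_one hNK
    obtain ⟨u, hu⟩ := Finset.card_eq_one.1 hcard
    have huN : u ∈ N ∧ i ∈ M₁ u := by
      rw [← Finset.mem_filter (p := fun x => i ∈ M₁ x), hu]
      exact Finset.mem_singleton_self u
    have hui : ∀ x ∈ N, i ∈ M₁ x → x = u := fun x hx hix => by
      rw [← Finset.mem_singleton, ← hu]
      exact Finset.mem_filter.2 ⟨hx, hix⟩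
    rcases (N.erase u).eq_empty_or_nonempty with hN | ⟨w, hw⟩
    · have hN' : ∀ x ∈ N, x = u := fun x hx => by
        by_contra hxu
        simpa [hN] using Finset.mem_erase.2 ⟨hxu, hx⟩
      refine ⟨c₁, h₁.proper, hcc₁, fun _ => i, fun x hx y hy _ => ?_, fun x hx => ?_⟩
      · rw [hN' x hx, hN' y hy]
      · rw [hN' x hx]
        exact ⟨hi, h₁.isMissing u huN.1 i huN.2⟩
    obtain ⟨w', M₂, h₂⟩ : ∃ w' M₂, F.IsFan c₁ (N.erase u) (K.erase i) w' M₂ := by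
      have hsub : ∀ x ∈ N.erase u, M₁ x ⊆ K.erase i := fun x hx k hk =>
        Finset.mem_erase.2 ⟨fun hki => Finset.ne_of_mem_erase hx
          (hui x (Finset.mem_of_mem_erase hx) (hki ▸ hk)),
          h₁.subset x (Finset.mem_of_mem_erase hx) hk⟩
      by_cases huu : u = u₀
      · have hw2 := h₁.card_two w (Finset.mem_of_mem_erase hw) (huu ▸ Finset.ne_of_mem_erase hw)
        obtain ⟨T, hT, hT1⟩ := Finset.exists_subset_card_eq (show 1 ≤ (M₁ w).card by omega)
        have hupd : ∀ x, Function.update M₁ w T x ⊆ M₁ x := fun x => by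
          by_cases hx : x = w
          · subst hx
            simpa using hT
          · simp [hx]
        refine ⟨w, Function.update M₁ w T, h₁.proper, fun x hx => (hupd x).trans (hsub x hx),
          fun x hx k hk => h₁.isMissing x (Finset.mem_of_mem_erase hx) k (hupd x hk), hw,
          by simpa using hT1, fun x hx hxw => ?_⟩
        simpa [hxw] using h₁.card_two x (Finset.mem_of_mem_erase hx)
          (huu ▸ Finset.ne_of_mem_erase hx)
      · exact ⟨u₀, M₁, h₁.proper, hsub,
          fun x hx => h₁.isMissing x (Finset.mem_of_mem_erase hx),
          Finset.mem_erase.2 ⟨Ne.symm huu, h₁.mem⟩, h₁.card_one,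
          fun x hx => h₁.card_two x (Finset.mem_of_mem_erase hx)⟩
    have hNc := Finset.card_erase_of_mem huN.1
    have hKc := Finset.card_erase_of_mem hi
    obtain ⟨c₂, hc₂, hcc₂, f, hf, hfm⟩ := ih h₂ (by omega) (by omega)
    refine ⟨c₂, hc₂, hcc₁.trans (hcc₂.mono (Finset.erase_subset i K)),
      Function.update f u i, fun x hx y hy hxy => ?_, fun x hx => ?_⟩
    · have hfi : ∀ x ∈ N, x ≠ u → f x ≠ i := fun x hx hxu =>
        Finset.ne_of_mem_erase (hfm x (Finset.mem_erase.2 ⟨hxu, hx⟩)).1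
      by_cases hxu : x = u <;> by_cases hyu : y = u
      · rw [hxu, hyu]
      · subst hxu
        exact absurd (by simpa [hyu] using hxy.symm) (hfi y hy hyu)
      · subst hyu
        exact absurd (by simpa [hxu] using hxy) (hfi x hx hxu)
      · exact hf (Finset.mem_erase.2 ⟨hxu, hx⟩) (Finset.mem_erase.2 ⟨hyu, hy⟩)
          (by simpa [hxu, hyu] using hxy)
    · by_cases hxu : x = u
      · subst hxu
        rw [Function.update_self]
        refine ⟨hi, fun y hy hyi => h₁.isMissing x hx i huN.2 hy ?_⟩
        by_cases hmem : c₁ s(x, y) ∈ K.erase i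
        · exact absurd hyi (Finset.ne_of_mem_erase ((hcc₂ _).1 hmem))
        · exact ((hcc₂ _).2 hmem).symm.trans hyi
      · rw [Function.update_of_ne hxu]
        have := hfm x (Finset.mem_erase.2 ⟨hxu, hx⟩)
        exact ⟨Finset.mem_of_mem_erase this.1, this.2⟩

open scoped Classical in
theorem SimpleGraph.card_le_card_missing_add_degree {V κ : Type*} [Fintype V]
    (F : SimpleGraph V) (c : Sym2 V → κ) (K : Finset κ) (x : V) :
    K.card ≤ (K.filter (F.IsMissing c x)).card + F.degree x := by
  have hsub : K ⊆ K.filter (F.IsMissing c x) ∪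
      (F.neighborFinset x).image (fun y => c s(x, y)) := by
    intro k hk
    by_cases hm : F.IsMissing c x k
    · simp [hk, hm]
    · have : ∃ y, F.Adj x y ∧ c s(x, y) = k := by
        simpa [SimpleGraph.IsMissing] using hm
      simp [this]
  refine (Finset.card_le_card hsub).trans ((Finset.card_union_le _ _).trans ?_)
  gcongr
  exact Finset.card_image_le

/-- The subgraph of `F` formed by the edges with both ends in `S`. -/
def SimpleGraph.within {V : Type*} (F : SimpleGraph V) (S : Set V) : SimpleGraph V where
  Adj x y := F.Adj x y ∧ x ∈ S ∧ y ∈ S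
  symm := ⟨fun _ _ h => ⟨h.1.symm, h.2.2, h.2.1⟩⟩
  loopless := ⟨fun _ h => F.irrefl h.1⟩

open scoped Classical in
/-- **Vizing's theorem**: more colors than the maximum degree suffice for a proper edge
coloring. -/
theorem SimpleGraph.exists_isProperEdgeColoring {V κ : Type*} [Fintype V] [Nonempty V]
    (F : SimpleGraph V) (K : Finset κ) (hK : ∀ x, F.degree x < K.card) :
    ∃ c : Sym2 V → κ, F.IsProperEdgeColoring c ∧ ∀ x y, F.Adj x y → c s(x, y) ∈ K := by
  suffices hS : ∀ S : Finset V, ∃ c : Sym2 V → κ, (F.within S).IsProperEdgeColoring c ∧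
      ∀ x y, (F.within S).Adj x y → c s(x, y) ∈ K by
    obtain ⟨c, hc, hcK⟩ := hS Finset.univ
    exact ⟨c, fun x y z hy hz => hc ⟨hy, by simp⟩ ⟨hz, by simp⟩,
      fun x y hxy => hcK x y ⟨hxy, by simp⟩⟩
  intro S
  induction S using Finset.induction_on with
  | empty =>
    have x := Classical.arbitrary V
    obtain ⟨k, hk⟩ := Finset.card_pos.1 ((Nat.zero_le _).trans_lt (hK x))
    exact ⟨fun _ => k, fun x y z hy => by simp [SimpleGraph.within] at hy, fun _ _ _ => hk⟩
  | insert v S hv ih =>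
    obtain ⟨c, hc, hcK⟩ := ih
    set N := (F.neighborFinset v).filter (· ∈ S) with hN
    have hmemN (x : V) : x ∈ N ↔ F.Adj v x ∧ x ∈ S := by simp [hN]
    have hmiss : ∀ u ∈ N, 2 ≤ (K.filter ((F.within S).IsMissing c u)).card := by
      intro u hu
      rw [hmemN] at hu
      have h1 := (F.within S).card_le_card_missing_add_degree c K u
      have h2 : (F.within S).degree u < F.degree u := by
        rw [← SimpleGraph.card_neighborFinset_eq_degree,
          ← SimpleGraph.card_neighborFinset_eq_degree]
        refine Finset.card_lt_card ⟨fun y hy => ?_, fun hsub => ?_⟩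
        · rw [SimpleGraph.mem_neighborFinset] at hy ⊢
          exact hy.1
        · have := hsub ((F.mem_neighborFinset u v).2 hu.1.symm)
          rw [SimpleGraph.mem_neighborFinset] at this
          exact hv this.2.2
      have := hK u
      omega
    obtain ⟨c', hc', hcK', f, hf, hfm⟩ : ∃ c' : Sym2 V → κ, (F.within S).IsProperEdgeColoring c' ∧
        (∀ x y, (F.within S).Adj x y → c' s(x, y) ∈ K) ∧
        ∃ f : V → κ, Set.InjOn f N ∧ ∀ u ∈ N, f u ∈ K ∧ (F.within S).IsMissing c' u (f u) := by
      rcases N.eq_empty_or_nonempty with hempty | ⟨u₀, hu₀⟩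
      · exact ⟨c, hc, hcK, fun x => c s(x, x), by simp [hempty], by simp [hempty]⟩
      have hex (u : V) : ∃ T : Finset κ, u ∈ N → T ⊆ K.filter ((F.within S).IsMissing c u) ∧
          T.card = if u = u₀ then 1 else 2 := by
        by_cases hu : u ∈ N
        · obtain ⟨T, hT⟩ := Finset.exists_subset_card_eq
            (show (if u = u₀ then 1 else 2) ≤ (K.filter ((F.within S).IsMissing c u)).card by
              have := hmiss u hu
              split_ifs <;> omega)
          exact ⟨T, fun _ => hT⟩
        · exact ⟨∅, fun h => absurd h hu⟩
      choose M hM using hex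
      have hfan : (F.within S).IsFan c N K u₀ M :=
        ⟨hc, fun u hu => (hM u hu).1.trans (Finset.filter_subset _ _),
          fun u hu i hi => (Finset.mem_filter.1 ((hM u hu).1 hi)).2, hu₀,
          by simpa using (hM u₀ hu₀).2, fun u hu hne => by simpa [hne] using (hM u hu).2⟩
      have hNK : N.card ≤ K.card :=
        (Finset.card_filter_le _ _).trans ((F.card_neighborFinset_eq_degree v).trans_le (hK v).le)
      obtain ⟨c', hc', hcc', hf⟩ := hfan.exists_injOn hNK
      exact ⟨c', hc', fun x y hxy => (hcc' _).1 (hcK x y hxy), hf⟩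
    let d : Sym2 V → κ := Sym2.lift
      ⟨fun x y => if x = v then f y else if y = v then f x else c' s(x, y), fun x y => by
        by_cases hx : x = v <;> by_cases hy : y = v <;> simp [hx, hy, Sym2.eq_swap]⟩
    have hdv (y : V) : d s(v, y) = f y := by simp [d]
    have hdv' (y : V) : d s(y, v) = f y := by rw [Sym2.eq_swap, hdv]
    have hd {x y : V} (hx : x ≠ v) (hy : y ≠ v) : d s(x, y) = c' s(x, y) := by simp [d, hx, hy]
    have hadjv {y : V} (h : (F.within ↑(insert v S)).Adj v y) : y ∈ N :=
      (hmemN y).2 ⟨h.1, (Finset.mem_insert.1 h.2.2).resolve_left h.1.ne'⟩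
    have hadj {x y : V} (h : (F.within ↑(insert v S)).Adj x y) (hx : x ≠ v) (hy : y ≠ v) :
        (F.within S).Adj x y :=
      ⟨h.1, (Finset.mem_insert.1 h.2.1).resolve_left hx,
        (Finset.mem_insert.1 h.2.2).resolve_left hy⟩
    refine ⟨d, fun x y z hy hz hyz => ?_, fun x y hxy => ?_⟩
    · by_cases hxv : x = v
      · subst hxv
        rw [hdv, hdv] at hyz
        exact hf (hadjv hy) (hadjv hz) hyz
      by_cases hyv : y = v <;> by_cases hzv : z = v
      · rw [hyv, hzv]
      · subst hyv
        rw [hdv', hd hxv hzv] at hyz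
        exact absurd hyz.symm ((hfm x (hadjv hy.symm)).2 (hadj hz hxv hzv))
      · subst hzv
        rw [hdv', hd hxv hyv] at hyz
        exact absurd hyz ((hfm x (hadjv hz.symm)).2 (hadj hy hxv hyv))
      · rw [hd hxv hyv, hd hxv hzv] at hyz
        exact hc' (hadj hy hxv hyv) (hadj hz hxv hzv) hyz
    · by_cases hxv : x = v
      · subst hxv
        rw [hdv]
        exact (hfm y (hadjv hxy)).1
      by_cases hyv : y = v
      · subst hyv
        rw [hdv']
        exact (hfm x (hadjv hxy.symm)).1
      · rw [hd hxv hyv]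
        exact hcK' x y (hadj hxy hxv hyv)

/-- A proper edge coloring with colors in `K` bounds the chromatic number of the line graph. -/
theorem SimpleGraph.IsProperEdgeColoring.lineGraph_colorable {V κ : Type*} {F : SimpleGraph V}
    {c : Sym2 V → κ} (hc : F.IsProperEdgeColoring c) (K : Finset κ)
    (hK : ∀ x y, F.Adj x y → c s(x, y) ∈ K) : F.lineGraph.Colorable K.card := by
  have hmem (e : F.edgeSet) : c e ∈ K := by
    obtain ⟨⟨x, y⟩, he⟩ := e
    exact hK x y he
  have hcol := (SimpleGraph.Coloring.mk (G := F.lineGraph) (α := K)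
    (fun e => ⟨c e, hmem e⟩) fun {e e'} hee' heq => ?_).colorable
  · simpa using hcol
  rw [SimpleGraph.lineGraph_adj_iff_exists] at hee'
  obtain ⟨hne, x, hx, hx'⟩ := hee'
  obtain ⟨e, he⟩ := e
  obtain ⟨e', he'⟩ := e'
  obtain ⟨y, rfl⟩ := Sym2.mem_iff_exists.1 hx
  obtain ⟨z, rfl⟩ := Sym2.mem_iff_exists.1 hx'
  have := hc he he' (congrArg Subtype.val heq)
  subst this
  exact hne rfl

theorem SimpleGraph.ncard_neighborSet_le_chromaticNumber_lineGraph {V : Type*} [Finite V]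
    (F : SimpleGraph V) (x : V) :
    ((F.neighborSet x).ncard : ℕ∞) ≤ F.lineGraph.chromaticNumber := by
  classical
  have := Fintype.ofFinite V
  let φ : F.neighborSet x → F.edgeSet := fun y => ⟨s(x, y), y.2⟩
  have hφ : Function.Injective φ := fun y z h => by
    have := congrArg Subtype.val h
    exact Subtype.ext (Sym2.congr_right.1 this)
  have hclique : F.lineGraph.IsClique (Finset.univ.image φ : Finset F.edgeSet) := by
    intro e he e' he' hne
    simp only [Finset.coe_image, Finset.coe_univ, Set.image_univ, Set.mem_range] at he he'
    obtain ⟨y, rfl⟩ := he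
    obtain ⟨z, rfl⟩ := he'
    rw [SimpleGraph.lineGraph_adj_iff_exists]
    exact ⟨hne, x, by simp [φ], by simp [φ]⟩
  have hcard := hclique.card_le_chromaticNumber
  rw [Finset.card_image_of_injective _ hφ, Finset.card_univ] at hcard
  rwa [← Nat.card_coe_set_eq, Nat.card_eq_fintype_card]

theorem relCayley_ncard_neighborSet_le {G : Type*} [Group G] [Finite G] (H : Subgroup G)
    (C : Set G) (hC : ∀ c ∈ C, c⁻¹ ∈ C) (x : G) :
    ((relCayley H C hC).neighborSet x).ncard ≤ C.ncard :=
  Set.ncard_le_ncard_of_injOn (x⁻¹ * ·) (fun _ hy => hy.2.2) (mul_right_injective x⁻¹).injOn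

theorem relCayley_ncard_neighborSet_one {G : Type*} [Group G] (H : Subgroup G) (C : Set G)
    (h1 : (1 : G) ∉ C) (hC : ∀ c ∈ C, c⁻¹ ∈ C) :
    ((relCayley H C hC).neighborSet 1).ncard = C.ncard := by
  congr 1
  ext y
  simp only [SimpleGraph.mem_neighborSet, relCayley, inv_one, one_mul]
  exact ⟨fun h => h.2.2, fun h => ⟨fun hy => h1 (hy ▸ h), Or.inl H.one_mem, h⟩⟩

open scoped Classical in
theorem relCayley_exists_isProperEdgeColoring {G : Type*} [Group G] [Fintype G]
    (H : Subgroup G) (C : Set G) (hC : ∀ c ∈ C, c⁻¹ ∈ C) (hCH : (C \ (H : Set G)).Nonempty) :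
    ∃ c : Sym2 G → G, (relCayley H C hC).IsProperEdgeColoring c ∧
      ∀ x y, (relCayley H C hC).Adj x y → c s(x, y) ∈ C.toFinset := by
  obtain ⟨a, haC, haH⟩ := hCH
  set F := (relCayley H C hC).within H
  set K : Finset G := insert a (C.toFinset.filter (· ∈ H)) with hKdef
  have hKmem (k : G) : k ∈ K ↔ k = a ∨ k ∈ C ∧ k ∈ H := by simp [hKdef]
  have hKC {k : G} (hk : k ∈ K) : k ∈ C := by
    rcases (hKmem k).1 hk with rfl | h
    exacts [haC, h.1]
  have hdeg (x : G) : F.degree x < K.card := by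
    rw [hKdef, Finset.card_insert_of_notMem (by simpa using fun _ => haH), Nat.lt_succ_iff,
      ← SimpleGraph.card_neighborFinset_eq_degree]
    refine Finset.card_le_card_of_injOn (x⁻¹ * ·) (fun y hy => ?_)
      (mul_right_injective x⁻¹).injOn
    rw [SimpleGraph.coe_neighborFinset] at hy
    simpa using ⟨hy.1.2.2, H.mul_mem (H.inv_mem hy.2.1) hy.2.2⟩
  obtain ⟨c, hc, hcK⟩ := F.exists_isProperEdgeColoring K hdeg
  have hmiss (x : G) : ∃ k ∈ K, F.IsMissing c x k := by
    have := F.card_le_card_missing_add_degree c K x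
    have := hdeg x
    obtain ⟨k, hk⟩ := Finset.card_pos.1
      (show 0 < (K.filter (F.IsMissing c x)).card by omega)
    exact ⟨k, Finset.mem_filter.1 hk⟩
  choose m hmK hm using hmiss
  let φ (x k : G) : G := if k = a then m x else k
  have hφK {x k : G} (hk : k ∉ H) (h : φ x k ∈ K) : k = a := by
    by_contra hka
    simp only [φ, hka, if_false] at h
    rcases (hKmem k).1 h with h | h
    exacts [hka h, hk h.2]
  have hφa {x : G} : φ x a = m x := by simp [φ]
  have hφne {x k : G} (hk : k ≠ a) : φ x k = k := by simp [φ, hk]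
  have hφ {x y k l : G} (hk : k ∉ H) (hl : l ∉ H) (h : φ x k = φ y l) : k = l := by
    by_cases hka : k = a
    · subst hka
      exact (hφK hl (h ▸ hφa ▸ hmK x)).symm
    by_cases hla : l = a
    · subst hla
      exact hφK hk (h ▸ hφa ▸ hmK y)
    · rwa [hφne hka, hφne hla] at h
  let d : Sym2 G → G := Sym2.lift
    ⟨fun x y => if x ∈ H then (if y ∈ H then c s(x, y) else φ x (x⁻¹ * y))
        else (if y ∈ H then φ y (y⁻¹ * x) else 1), fun x y => by
      by_cases hx : x ∈ H <;> by_cases hy : y ∈ H <;> simp [hx, hy, Sym2.eq_swap]⟩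
  have hdin {x y : G} (hx : x ∈ H) (hy : y ∈ H) : d s(x, y) = c s(x, y) := by simp [d, hx, hy]
  have hdout {x y : G} (hx : x ∈ H) (hy : y ∉ H) : d s(x, y) = φ x (x⁻¹ * y) := by
    simp [d, hx, hy]
  have hout {x y : G} (hx : x ∈ H) (hy : y ∉ H) : x⁻¹ * y ∉ H := by
    rwa [H.mul_mem_cancel_left (H.inv_mem hx)]
  have hmixed {x y z : G} (hx : x ∈ H) (hy : y ∈ H) (hz : z ∉ H)
      (hxy : (relCayley H C hC).Adj x y) : d s(x, y) ≠ d s(x, z) := by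
    rw [hdin hx hy, hdout hx hz]
    intro h
    have hF : F.Adj x y := ⟨hxy, hx, hy⟩
    have hza := hφK (hout hx hz) (h ▸ hcK x y hF)
    rw [hza, hφa] at h
    exact hm x hF h
  have hdC {x y : G} (hx : x ∈ H) (hxy : (relCayley H C hC).Adj x y) : d s(x, y) ∈ C := by
    by_cases hy : y ∈ H
    · rw [hdin hx hy]
      exact hKC (hcK x y ⟨hxy, hx, hy⟩)
    · rw [hdout hx hy]
      by_cases ha : x⁻¹ * y = a
      · rw [ha, hφa]
        exact hKC (hmK x)
      · rw [hφne ha]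
        exact hxy.2.2
  refine ⟨d, fun x y z hy hz hyz => ?_, fun x y hxy => ?_⟩
  · by_cases hx : x ∈ H
    · by_cases hyH : y ∈ H <;> by_cases hzH : z ∈ H
      · rw [hdin hx hyH, hdin hx hzH] at hyz
        exact hc ⟨hy, hx, hyH⟩ ⟨hz, hx, hzH⟩ hyz
      · exact absurd hyz (hmixed hx hyH hzH hy)
      · exact absurd hyz.symm (hmixed hx hzH hyH hz)
      · rw [hdout hx hyH, hdout hx hzH] at hyz
        exact mul_left_cancel (hφ (hout hx hyH) (hout hx hzH) hyz)
    · have hyH := hy.2.1.resolve_left hx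
      have hzH := hz.2.1.resolve_left hx
      rw [Sym2.eq_swap, hdout hyH hx, Sym2.eq_swap, hdout hzH hx] at hyz
      exact inv_injective (mul_right_cancel (hφ (hout hyH hx) (hout hzH hx) hyz))
  · rw [Set.mem_toFinset]
    rcases hxy.2.1 with hx | hy
    · exact hdC hx hxy
    · rw [Sym2.eq_swap]
      exact hdC hy hxy.symm

/-- Theorem 4.7: if `C \ H ≠ ∅`, then `Γ = Cay(G,H,C)` is a class one graph: its maximum
degree is `Δ(Γ) = |C|`, and its chromatic index (the chromatic number of its line graph)
equals `|C|`. -/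
theorem statement14 {G : Type*} [Group G] [Finite G] (H : Subgroup G) (hH : H ≠ ⊤)
    (C : Set G) (h1 : (1 : G) ∉ C) (hC : ∀ c ∈ C, c⁻¹ ∈ C)
    (hCH : (C \ (H : Set G)).Nonempty) :
    (∀ x : G, ((relCayley H C hC).neighborSet x).ncard ≤ C.ncard) ∧
    (∃ x : G, ((relCayley H C hC).neighborSet x).ncard = C.ncard) ∧
    (relCayley H C hC).lineGraph.chromaticNumber = (C.ncard : ℕ∞) := by
  refine ⟨relCayley_ncard_neighborSet_le H C hC,
    ⟨1, relCayley_ncard_neighborSet_one H C h1 hC⟩, le_antisymm ?_ ?_⟩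
  · classical
    have := Fintype.ofFinite G
    obtain ⟨c, hc, hcC⟩ := relCayley_exists_isProperEdgeColoring H C hC hCH
    rw [Set.ncard_eq_toFinset_card']
    exact (hc.lineGraph_colorable _ hcC).chromaticNumber_le
  · rw [← relCayley_ncard_neighborSet_one H C h1 hC]
    exact SimpleGraph.ncard_neighborSet_le_chromaticNumber_lineGraph _ 1
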